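/- For all natural numbers n ≥ 1 and m ≥ 1, there exist real polynomials f of degree n and g of degree m, with the constant coefficient of g nonzero, such that the averaged function F₀ has exactly [n/2] + [m/2] + 1 distinct zeros in (0, ∞), and at each such zero a the derivative of F₀ is nonzero (so each zero is simple and has nonzero Brouwer degree sign(F₀′(a)) ≠ 0). -/

import Mathlib

open Real intervalIntegral Finset

theorem Polynomial.signVariations_add_one_le_card_support {P : Polynomial ℝ} (hP : P ≠ 0) :
    P.signVariations + 1 ≤ P.support.card := by
  induction hd : P.support.card generalizing P with
  | zero => simp_all
  | succ k ih =>
    have hcard := P.card_support_eraseLead' hd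
    by_cases h : P.eraseLead = 0
    · simp [Polynomial.signVariations_eq_eraseLead_add_ite hP, h, hP]
    · have h₁ := ih h hcard
      have h₂ := P.signVariations_le_eraseLead_succ
      omega

theorem Polynomial.exists_ne_zero_support_subset_forall_eval_eq_zero {K : Type*} [Field K]
    (E : Finset ℕ) (T : Finset K) (h : T.card < E.card) :
    ∃ P : Polynomial K, P ≠ 0 ∧ P.support ⊆ E ∧ ∀ x ∈ T, P.eval x = 0 := by
  let L : (E → K) →ₗ[K] (T → K) :=
    Matrix.mulVecLin (Matrix.of fun (x : T) (e : E) => (x : K) ^ (e : ℕ))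
  have hker : LinearMap.ker L ≠ ⊥ := L.ker_ne_bot_of_finrank_lt (by simpa using h)
  obtain ⟨c, hc, hc0⟩ := (Submodule.ne_bot_iff _).1 hker
  have hcoeff (k : ℕ) : (∑ e : E, Polynomial.monomial (e : ℕ) (c e)).coeff k =
      ∑ e : E, if (e : ℕ) = k then c e else 0 := by
    simp [Polynomial.coeff_monomial]
  refine ⟨∑ e : E, Polynomial.monomial (e : ℕ) (c e), ?_, ?_, ?_⟩
  · intro h0
    refine hc0 ?_
    ext e
    have := hcoeff e
    rw [h0] at this
    simpa [Subtype.val_inj] using this.symm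
  · intro k hk
    by_contra hkE
    rw [Polynomial.mem_support_iff, hcoeff] at hk
    refine hk (Finset.sum_eq_zero fun e _ => if_neg ?_)
    rintro rfl
    exact hkE e.2
  · intro x hx
    have := congrFun (LinearMap.mem_ker.1 hc) ⟨x, hx⟩
    simpa [L, Matrix.mulVec, dotProduct, Polynomial.eval_finsetSum, mul_comm] using this

theorem Polynomial.exists_support_eq_pos_roots_simple (E : Finset ℕ) (hE : E.Nonempty) :
    ∃ P : Polynomial ℝ, P.support = E ∧ ∃ S : Finset ℝ, S.card + 1 = E.card ∧
      (∀ r : ℝ, (0 < r ∧ P.eval r = 0) ↔ r ∈ S) ∧ ∀ r ∈ S, P.derivative.eval r ≠ 0 := by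
  obtain ⟨k, hk⟩ : ∃ k, E.card = k + 1 := ⟨E.card - 1, by have := hE.card_pos; omega⟩
  let T : Finset ℝ := (Finset.range k).image fun i : ℕ => (i : ℝ) + 1
  have hTcard : T.card = k := by
    rw [Finset.card_image_of_injective _ fun i j hij => by simpa using hij, Finset.card_range]
  have hTpos : ∀ x ∈ T, 0 < x := by
    intro x hx
    obtain ⟨i, -, rfl⟩ := Finset.mem_image.1 hx
    positivity
  obtain ⟨P, hP, hPE, hPT⟩ :=
    Polynomial.exists_ne_zero_support_subset_forall_eval_eq_zero E T (by omega)
  have hle : T.val ≤ P.roots.filter (0 < ·) := by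
    refine (Multiset.le_iff_subset T.nodup).2 fun x hx => ?_
    exact Multiset.mem_filter.2 ⟨(Polynomial.mem_roots hP).2 (hPT x hx), hTpos x hx⟩
  have hcount := P.roots_countP_pos_le_signVariations
  rw [Multiset.countP_eq_card_filter] at hcount
  have hsupp := Polynomial.signVariations_add_one_le_card_support hP
  have hsub := Finset.card_le_card hPE
  have hTle := Multiset.card_le_card hle
  rw [Finset.card_val] at hTle
  have heq : T.val = P.roots.filter (0 < ·) :=
    Multiset.eq_of_le_of_card_le hle (by rw [Finset.card_val]; omega)
  have hmem (r : ℝ) : (0 < r ∧ P.eval r = 0) ↔ r ∈ T := by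
    rw [← Finset.mem_val, heq, Multiset.mem_filter, Polynomial.mem_roots hP, Polynomial.IsRoot,
      and_comm]
  refine ⟨P, Finset.eq_of_subset_of_card_le hPE (by omega), T, by omega, hmem, ?_⟩
  intro r hr hder
  have hroot := (hmem r).2 hr
  have hmult := (Polynomial.one_lt_rootMultiplicity_iff_isRoot hP).2 ⟨hroot.2, hder⟩
  rw [← Polynomial.count_roots, ← Multiset.count_filter_of_pos hroot.1, ← heq] at hmult
  exact absurd hmult (not_lt.2 (Multiset.nodup_iff_count_le_one.1 T.nodup r))

theorem Function.Antiperiodic.intervalIntegral_two_mul_eq_zero {f : ℝ → ℝ} {T : ℝ}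
    (hf : Function.Antiperiodic f T) : ∫ x in (0 : ℝ)..(2 * T), f x = 0 := by
  have h₁ : ∫ x in (0 : ℝ)..(2 * T), f (x + T) = ∫ x in T..(T + 2 * T), f x := by
    rw [intervalIntegral.integral_comp_add_right, zero_add, add_comm]
  have h₂ := hf.periodic_two_mul.intervalIntegral_add_eq T 0
  simp_rw [hf _, intervalIntegral.integral_neg] at h₁
  rw [zero_add] at h₂
  linarith

theorem integral_mul_cos_pow_of_odd {w : ℝ → ℝ} (hw : Function.Periodic w π) {k : ℕ}
    (hk : Odd k) : ∫ θ in (0 : ℝ)..(2 * π), w θ * Real.cos θ ^ k = 0 :=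
  Function.Antiperiodic.intervalIntegral_two_mul_eq_zero fun θ => by
    rw [hw θ, Real.cos_add_pi, hk.neg_pow, mul_neg]

theorem integral_mul_cos_pow_pos_of_even {w : ℝ → ℝ} (hw : Continuous w) (hw0 : ∀ θ, 0 ≤ w θ)
    (hwpos : 0 < w (π / 4)) {k : ℕ} (hk : Even k) :
    0 < ∫ θ in (0 : ℝ)..(2 * π), w θ * Real.cos θ ^ k := by
  have hπ := Real.pi_pos
  refine intervalIntegral.integral_pos (by positivity) (by fun_prop)
    (fun θ _ => mul_nonneg (hw0 θ) (hk.pow_nonneg _)) ⟨π / 4, ⟨by positivity, by linarith⟩, ?_⟩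
  rw [Real.cos_pi_div_four]
  positivity

theorem integral_mul_sum_mul_cos_pow {w : ℝ → ℝ} (hw : Continuous w) (c : ℕ → ℝ) (k : ℕ) (r : ℝ) :
    ∫ θ in (0 : ℝ)..(2 * π), w θ * ∑ i ∈ Finset.range k, c i * (r * Real.cos θ) ^ i =
      ∑ i ∈ Finset.range k, c i * r ^ i * ∫ θ in (0 : ℝ)..(2 * π), w θ * Real.cos θ ^ i := by
  simp_rw [Finset.mul_sum]
  rw [intervalIntegral.integral_finsetSum fun i _ =>
    Continuous.intervalIntegrable (by fun_prop) _ _]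
  refine Finset.sum_congr rfl fun i _ => ?_
  rw [← intervalIntegral.integral_const_mul]
  congr 1 with θ
  rw [mul_pow]
  ring

/-- Any prescribed even coefficients are the moments of some polynomial against a `π`-periodic
weight on the circle. -/
theorem exists_average_mul_cos_pow_eq {w : ℝ → ℝ} (hw : Continuous w) (hw0 : ∀ θ, 0 ≤ w θ)
    (hwpos : 0 < w (π / 4)) (hper : Function.Periodic w π) (d : ℕ → ℝ) (k : ℕ)
    (hd : ∀ i ∈ Finset.range (k + 1), Even i → d i ≠ 0) :
    ∃ c : ℕ → ℝ, (∀ i ∈ Finset.range (k + 1), c i ≠ 0) ∧ ∀ r : ℝ,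
      (1 / (2 * π)) * ∫ θ in (0 : ℝ)..(2 * π),
        w θ * ∑ i ∈ Finset.range (k + 1), c i * (r * Real.cos θ) ^ i =
      ∑ i ∈ Finset.range (k + 1) with Even i, d i * r ^ i := by
  have hπ := Real.pi_pos
  refine ⟨fun i => if Even i then
    2 * π * d i / ∫ θ in (0 : ℝ)..(2 * π), w θ * Real.cos θ ^ i else 1, ?_, ?_⟩
  · intro i hi
    dsimp only
    split_ifs with h
    · have := integral_mul_cos_pow_pos_of_even hw hw0 hwpos h
      have := hd i hi h
      positivity
    · exact one_ne_zero
  · intro r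
    rw [integral_mul_sum_mul_cos_pow hw, Finset.mul_sum, Finset.sum_filter]
    refine Finset.sum_congr rfl fun i _ => ?_
    split_ifs with h
    · have := (integral_mul_cos_pow_pos_of_even hw hw0 hwpos h).ne'
      field_simp
    · rw [integral_mul_cos_pow_of_odd hper (Nat.not_even_iff_odd.1 h), mul_zero, mul_zero]

theorem card_filter_even_range_succ (k : ℕ) :
    ((Finset.range (k + 1)).filter Even).card = k / 2 + 1 := by
  induction k with
  | zero => rfl
  | succ k ih =>
    rw [Finset.range_add_one, Finset.filter_insert]
    split_ifs with h
    · rw [Finset.card_insert_of_notMem (by simp), ih]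
      grind
    · rw [ih]
      grind

theorem Real.sign_mul_self_eq_abs (x : ℝ) : Real.sign x * x = |x| := by
  rcases lt_trichotomy x 0 with h | rfl | h
  · rw [Real.sign_of_neg h, abs_of_neg h, neg_one_mul]
  · simp
  · rw [Real.sign_of_pos h, abs_of_pos h, one_mul]

theorem averaged_function_max_simple_zeros (n m : ℕ) (hn : 1 ≤ n) (hm : 1 ≤ m) :
    ∃ a b : ℕ → ℝ, a n ≠ 0 ∧ b m ≠ 0 ∧ b 0 ≠ 0 ∧
      ∀ F₀ : ℝ → ℝ,
        F₀ = (fun r => (1 / (2 * π)) *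
          ∫ θ in (0:ℝ)..(2 * π),
            ((∑ i ∈ Finset.range (n + 1), a i * (r * Real.cos θ) ^ i) * r * (Real.sin θ) ^ 2 +
              Real.sign (Real.sin θ) * Real.sin θ *
                ∑ j ∈ Finset.range (m + 1), b j * (r * Real.cos θ) ^ j)) →
        ∃ S : Finset ℝ, S.card = n / 2 + m / 2 + 1 ∧
          (∀ r : ℝ, (0 < r ∧ F₀ r = 0) ↔ r ∈ S) ∧
          ∀ r ∈ S, deriv F₀ r ≠ 0 := by
  let A := (Finset.range (n + 1)).filter Even
  let B := (Finset.range (m + 1)).filter Even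
  have hdisj : Disjoint (A.map (addRightEmbedding 1)) B := by
    rw [Finset.disjoint_left]
    intro x hx hxB
    obtain ⟨i, hi, rfl⟩ := Finset.mem_map.1 hx
    have h₁ := (Finset.mem_filter.1 hi).2
    have h₂ := (Finset.mem_filter.1 hxB).2
    exact (Nat.even_add_one.1 h₂) h₁
  obtain ⟨P, hPE, S, hS, hroot, hder⟩ :=
    Polynomial.exists_support_eq_pos_roots_simple ((A.map (addRightEmbedding 1)).disjUnion B hdisj)
      ⟨0, by simp [B]⟩
  have hcA : ∀ i ∈ Finset.range (n + 1), Even i → P.coeff (i + 1) ≠ 0 := fun i hi he => by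
    rw [← Polynomial.mem_support_iff, hPE]
    exact Finset.mem_disjUnion.2 (.inl (Finset.mem_map.2 ⟨i, Finset.mem_filter.2 ⟨hi, he⟩, rfl⟩))
  have hcB : ∀ i ∈ Finset.range (m + 1), Even i → P.coeff i ≠ 0 := fun i hi he => by
    rw [← Polynomial.mem_support_iff, hPE]
    exact Finset.mem_disjUnion.2 (.inr (Finset.mem_filter.2 ⟨hi, he⟩))
  have hsin : 0 < Real.sin (π / 4) := by
    rw [Real.sin_pi_div_four]
    positivity
  obtain ⟨a, ha, haI⟩ := exists_average_mul_cos_pow_eq (w := fun θ => Real.sin θ ^ 2)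
    (by fun_prop) (fun θ => sq_nonneg _) (pow_pos hsin 2)
    (fun θ => by simp [Real.sin_add_pi]) (fun i => P.coeff (i + 1)) n hcA
  obtain ⟨b, hb, hbI⟩ := exists_average_mul_cos_pow_eq (w := fun θ => |Real.sin θ|)
    (by fun_prop) (fun θ => abs_nonneg _) (abs_pos.2 hsin.ne')
    (fun θ => by simp [Real.sin_add_pi]) P.coeff m hcB
  refine ⟨a, b, ha n (by simp), hb m (by simp), hb 0 (by simp), ?_⟩
  rintro F₀ rfl
  have hF : (fun r => (1 / (2 * π)) *
      ∫ θ in (0:ℝ)..(2 * π),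
        ((∑ i ∈ Finset.range (n + 1), a i * (r * Real.cos θ) ^ i) * r * (Real.sin θ) ^ 2 +
          Real.sign (Real.sin θ) * Real.sin θ *
            ∑ j ∈ Finset.range (m + 1), b j * (r * Real.cos θ) ^ j)) = fun r => P.eval r := by
    funext r
    have hint (θ : ℝ) :
        (∑ i ∈ Finset.range (n + 1), a i * (r * Real.cos θ) ^ i) * r * (Real.sin θ) ^ 2 +
          Real.sign (Real.sin θ) * Real.sin θ *
            ∑ j ∈ Finset.range (m + 1), b j * (r * Real.cos θ) ^ j =
        r * (Real.sin θ ^ 2 * ∑ i ∈ Finset.range (n + 1), a i * (r * Real.cos θ) ^ i) +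
          |Real.sin θ| * ∑ j ∈ Finset.range (m + 1), b j * (r * Real.cos θ) ^ j := by
      rw [Real.sign_mul_self_eq_abs]
      ring
    simp_rw [hint]
    rw [intervalIntegral.integral_add (Continuous.intervalIntegrable (by fun_prop) _ _)
      (Continuous.intervalIntegrable (by fun_prop) _ _), intervalIntegral.integral_const_mul,
      mul_add, mul_left_comm, haI, hbI, Polynomial.eval_eq_sum, Polynomial.sum, hPE,
      Finset.sum_disjUnion, Finset.sum_map, Finset.mul_sum]
    congr 1
    refine Finset.sum_congr rfl fun i _ => ?_
    rw [addRightEmbedding_apply, pow_succ]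
    ring
  rw [hF]
  refine ⟨S, ?_, hroot, fun r hr => ?_⟩
  · rw [Finset.card_disjUnion, Finset.card_map, card_filter_even_range_succ,
      card_filter_even_range_succ] at hS
    omega
  · rw [Polynomial.deriv]
    exact hder r hr
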